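/- Let w ∈ W and s ∈ S with l(ws) < l(w). Then in H_x(W): T_{w̲}·(T_s + 1) = (x + 1)·T_{w̲}. -/

import Mathlib

/-!
Artin–Tits braid monoid of a finite Coxeter system `(W,S)`, presented with one
generator `𝐰` for each `w ∈ W` and relations `𝐰₁𝐰₂ = 𝐰` when `w = w₁w₂` with
`l(w₁) + l(w₂) = l(w)`.
-/

variable {B : Type*} {W : Type*} [Group W] {M : CoxeterMatrix B}

/-- The defining relations of the braid monoid. -/
def braidRel (cs : CoxeterSystem M W) : FreeMonoid W → FreeMonoid W → Prop := fun a b =>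
  ∃ w₁ w₂ : W, cs.length (w₁ * w₂) = cs.length w₁ + cs.length w₂ ∧
    a = FreeMonoid.of w₁ * FreeMonoid.of w₂ ∧ b = FreeMonoid.of (w₁ * w₂)

/-- The braid monoid `B⁺` of the Coxeter system `cs`. -/
abbrev BraidMonoid (cs : CoxeterSystem M W) := PresentedMonoid (braidRel cs)

/-- The canonical element `𝐰 ∈ B⁺` attached to `w ∈ W`. -/
def bOf (cs : CoxeterSystem M W) (w : W) : BraidMonoid cs := PresentedMonoid.of (braidRel cs) w

/-- The canonical morphism `β : B⁺ → W`, `𝐰 ↦ w`. -/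
noncomputable def bPi (cs : CoxeterSystem M W) : BraidMonoid cs →* W :=
  PresentedMonoid.lift (fun w : W => w) (by
    rintro a b ⟨w₁, w₂, -, rfl, rfl⟩
    simp)

/-- The additive length morphism `l : B⁺ → ℕ` with `l(𝐬) = 1`; recorded as a morphism
to `Multiplicative ℕ`. It sends `𝐰` to `l(w)`. -/
noncomputable def bLen (cs : CoxeterSystem M W) : BraidMonoid cs →* Multiplicative ℕ :=
  PresentedMonoid.lift (fun w : W => Multiplicative.ofAdd (cs.length w)) (by
    rintro a b ⟨w₁, w₂, h, rfl, rfl⟩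
    simp [← ofAdd_add, h])

/-- The set `𝐖 = {b ∈ B⁺ : l(b) = l(β(b))}`, a copy of `W` inside `B⁺`. -/
def bW (cs : CoxeterSystem M W) : Set (BraidMonoid cs) :=
  {b | bLen cs b = Multiplicative.ofAdd (cs.length (bPi cs b))}


/-- The Bruhat order on `W`: `v ≤ w` iff some (equivalently, every) reduced expression
of `w` has a subsequence with product `v`. -/
def bruhatLE (cs : CoxeterSystem M W) (v w : W) : Prop :=
  ∃ ω : List B, cs.wordProd ω = w ∧ ω.length = cs.length w ∧
    ∃ ω' : List B, ω'.Sublist ω ∧ cs.wordProd ω' = v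

/-- The coefficient ring `A = ℤ[x^{1/2}, x^{-1/2}]`, realized as Laurent polynomials
over `ℤ` with variable `x^{1/2}`. -/
abbrev LaurA := LaurentPolynomial ℤ

/-- The element `x = (x^{1/2})²` of `A`. -/
noncomputable def xA : LaurA := LaurentPolynomial.T 2

/-- The monoid algebra `A[B⁺]`. -/
abbrev HeckeCarrier (cs : CoxeterSystem M W) := MonoidAlgebra LaurA (BraidMonoid cs)

/-- The relations defining the Hecke algebra: the generators `(𝐬 + 1)(𝐬 − x)` of the
two-sided ideal are identified with `0`. -/
def heckeRel (cs : CoxeterSystem M W) : HeckeCarrier cs → HeckeCarrier cs → Prop :=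
  fun a b => ∃ i : B,
    a = (MonoidAlgebra.of LaurA (BraidMonoid cs) (bOf cs (cs.simple i)) + 1) *
        (MonoidAlgebra.of LaurA (BraidMonoid cs) (bOf cs (cs.simple i)) -
          algebraMap LaurA (HeckeCarrier cs) xA) ∧
    b = 0

/-- The Iwahori–Hecke algebra `H_x(W)`: the quotient of `A[B⁺]` by the two-sided ideal
generated by the `(𝐬 + 1)(𝐬 − x)`, `s ∈ S`. -/
abbrev Hecke (cs : CoxeterSystem M W) := RingQuot (heckeRel cs)

/-- `T_w`: the image of `𝐰 ∈ B⁺` in `H_x(W)`. -/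
noncomputable def Tmap (cs : CoxeterSystem M W) (w : W) : Hecke cs :=
  RingQuot.mkRingHom (heckeRel cs) (MonoidAlgebra.of LaurA (BraidMonoid cs) (bOf cs w))

open scoped Classical in
/-- `T_{w̲} = Σ_{v ≤ w} T_v`, the sum over the Bruhat order. -/
noncomputable def Tbar [Fintype W] (cs : CoxeterSystem M W) (w : W) : Hecke cs :=
  ∑ v : W, if bruhatLE cs v w then Tmap cs v else 0

namespace CoxeterSystem

/-! ### The strong exchange property -/

section StrongExchange

open scoped Classical in
/-- The action of the simple reflection `s i` on pairs (group element, sign): it conjugates the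
first component by `s i` and flips the sign exactly when the first component is `s i`. -/
noncomputable def signedConj (cs : CoxeterSystem M W) (i : B) : Function.End (W × ZMod 2) :=
  fun p => (cs.simple i * p.1 * cs.simple i, p.2 + if p.1 = cs.simple i then 1 else 0)

open scoped Classical in
theorem signedConj_mul_pow_apply (cs : CoxeterSystem M W) (i j : B) (m : ℕ) (t : W) (e : ZMod 2) :
    ((cs.signedConj i * cs.signedConj j) ^ m) (t, e) =
      ((cs.simple i * cs.simple j) ^ m * t * ((cs.simple i * cs.simple j) ^ m)⁻¹,
        e + ∑ k ∈ Finset.range (2 * m),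
          if t = cs.simple j * (cs.simple i * cs.simple j) ^ k then 1 else 0) := by
  set p := cs.simple i * cs.simple j with hp
  have hsp : ∀ k : ℕ, (p ^ k)⁻¹ * cs.simple j = cs.simple j * p ^ k := by
    intro k
    have h : SemiconjBy (cs.simple j) p p⁻¹ := by
      simp [SemiconjBy, hp, mul_assoc]
    simpa using (h.pow_right k).eq.symm
  induction m with
  | zero =>
    simp only [pow_zero, mul_zero, Finset.sum_range_zero, add_zero, one_mul, inv_one, mul_one]
    rfl
  | succ m ih =>
    rw [pow_succ']
    change cs.signedConj i (cs.signedConj j (((cs.signedConj i * cs.signedConj j) ^ m) (t, e))) = _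
    rw [ih]
    have h₁ : (p ^ m * t * (p ^ m)⁻¹ = cs.simple j) ↔ t = cs.simple j * p ^ (2 * m) := by
      rw [mul_inv_eq_iff_eq_mul, ← eq_inv_mul_iff_mul_eq, ← mul_assoc, hsp, mul_assoc, two_mul,
        pow_add]
    have h₂ : (cs.simple j * (p ^ m * t * (p ^ m)⁻¹) * cs.simple j = cs.simple i) ↔
        t = cs.simple j * p ^ (2 * m + 1) := by
      have h₃ : cs.simple j * (p ^ m * t * (p ^ m)⁻¹) * cs.simple j = cs.simple i ↔
          p ^ m * t * (p ^ m)⁻¹ = cs.simple j * p := by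
        rw [← eq_mul_inv_iff_mul_eq, ← eq_inv_mul_iff_mul_eq]
        simp [hp]
      rw [h₃, mul_inv_eq_iff_eq_mul, ← eq_inv_mul_iff_mul_eq, ← mul_assoc, ← mul_assoc, hsp,
        mul_assoc, mul_assoc, ← pow_succ', ← pow_add, show m + (m + 1) = 2 * m + 1 by ring]
    rw [show 2 * (m + 1) = 2 * m + 1 + 1 by ring, Finset.sum_range_succ, Finset.sum_range_succ,
      pow_succ']
    simp only [signedConj, h₁, h₂, add_assoc, Prod.mk.injEq, and_true]
    simp [hp, mul_assoc]

theorem isLiftable_signedConj (cs : CoxeterSystem M W) : M.IsLiftable cs.signedConj := by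
  classical
  intro i j
  funext ⟨t, e⟩
  rw [signedConj_mul_pow_apply, two_mul, Finset.sum_range_add]
  simp only [pow_add, cs.simple_mul_simple_pow, one_mul, CharTwo.add_self_eq_zero, inv_one,
    mul_one, add_zero]
  rfl

/-- The action of `W` on pairs (group element, sign) extending `signedConj`. -/
noncomputable def signedAction (cs : CoxeterSystem M W) : W →* Function.End (W × ZMod 2) :=
  cs.lift ⟨cs.signedConj, cs.isLiftable_signedConj⟩

theorem signedAction_mul_apply (cs : CoxeterSystem M W) (u v : W) (p : W × ZMod 2) :
    cs.signedAction (u * v) p = cs.signedAction u (cs.signedAction v p) := by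
  rw [map_mul]
  rfl

open scoped Classical in
theorem signedAction_wordProd (cs : CoxeterSystem M W) (ω : List B) (t : W) (e : ZMod 2) :
    cs.signedAction (cs.wordProd ω) (t, e) =
      (cs.wordProd ω * t * (cs.wordProd ω)⁻¹, e + (cs.rightInvSeq ω).count t) := by
  induction ω with
  | nil =>
    simp only [wordProd_nil, map_one, one_mul, inv_one, mul_one, rightInvSeq_nil, List.count_nil,
      Nat.cast_zero, add_zero]
    rfl
  | cons i ω ih =>
    rw [wordProd_cons, signedAction_mul_apply, ih, signedAction, lift_apply_simple]
    have h : (cs.wordProd ω * t * (cs.wordProd ω)⁻¹ = cs.simple i) ↔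
        (cs.wordProd ω)⁻¹ * cs.simple i * cs.wordProd ω = t := by
      rw [mul_inv_eq_iff_eq_mul, ← eq_inv_mul_iff_mul_eq, ← mul_assoc, eq_comm]
    simp only [signedConj, h, rightInvSeq, List.count_cons, beq_iff_eq]
    simp [mul_assoc, add_assoc]

theorem signedAction_eq (cs : CoxeterSystem M W) (w t : W) (e : ZMod 2) :
    cs.signedAction w (t, e) = (w * t * w⁻¹, e + (cs.signedAction w (t, 0)).2) := by
  obtain ⟨ω, rfl⟩ := cs.wordProd_surjective w
  simp [signedAction_wordProd]

theorem IsReflection.signedAction_self {cs : CoxeterSystem M W} {t : W} (ht : cs.IsReflection t)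
    (e : ZMod 2) : cs.signedAction t (t, e) = (t, e + 1) := by
  obtain ⟨u, i, rfl⟩ := ht
  have hs (a : ZMod 2) :
      cs.signedAction (cs.simple i) (cs.simple i, a) = (cs.simple i, a + 1) := by
    simp [signedAction, signedConj]
  set t := u * cs.simple i * u⁻¹ with ht
  have hconj : u⁻¹ * t * u⁻¹⁻¹ = cs.simple i := by simp [ht, mul_assoc]
  have hcancel : cs.signedAction u (cs.signedAction u⁻¹ (t, e)) = (t, e) := by
    rw [← signedAction_mul_apply, mul_inv_cancel, map_one]
    rfl
  rw [signedAction_eq cs u⁻¹ t e, hconj, signedAction_eq, Prod.mk.injEq] at hcancel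
  conv_lhs => rw [ht, signedAction_mul_apply, signedAction_mul_apply, ← ht]
  rw [signedAction_eq cs u⁻¹ t e, hconj, hs, signedAction_eq, Prod.mk.injEq]
  exact ⟨hcancel.1, by rw [add_right_comm, hcancel.2]⟩

/-- A right inversion of `π ω` occurs in the right inversion sequence of `ω`, even if `ω` is not
reduced. -/
theorem IsRightInversion.mem_rightInvSeq {cs : CoxeterSystem M W} {ω : List B} {t : W}
    (h : cs.IsRightInversion (cs.wordProd ω) t) : t ∈ cs.rightInvSeq ω := by
  classical
  by_contra hmem
  obtain ⟨ω', hω', hprod⟩ := cs.exists_isReduced (cs.wordProd ω * t)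
  have h₁ : cs.signedAction (cs.wordProd ω * t) (t, 0) =
      cs.signedAction (cs.wordProd ω) (t, 1) := by
    rw [signedAction_mul_apply, h.1.signedAction_self, zero_add]
  rw [hprod, signedAction_wordProd, signedAction_wordProd, List.count_eq_zero.mpr hmem,
    Prod.mk.injEq] at h₁
  have hmem' : t ∈ cs.rightInvSeq ω' := by
    by_contra hn
    simp [List.count_eq_zero.mpr hn] at h₁
  have h₂ := (cs.isRightInversion_of_mem_rightInvSeq hω' hmem').2
  rw [← hprod, mul_assoc, h.1.mul_self, mul_one] at h₂
  exact lt_asymm h₂ h.2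

/-- The **strong exchange property**. -/
theorem IsRightInversion.exists_eraseIdx {cs : CoxeterSystem M W} {ω : List B} {t : W}
    (h : cs.IsRightInversion (cs.wordProd ω) t) :
    ∃ j < ω.length, cs.wordProd ω * t = cs.wordProd (ω.eraseIdx j) := by
  obtain ⟨j, hj, hjt⟩ := List.mem_iff_getElem.mp h.mem_rightInvSeq
  refine ⟨j, by simpa using hj, ?_⟩
  rw [← cs.wordProd_mul_getD_rightInvSeq, List.getD_eq_getElem _ 1 hj, hjt]

end StrongExchange

/-! ### Bruhat order -/

/-- `BruhatStep v w` holds if `w * t = v` for some right inversion `t` of `w`. -/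
def BruhatStep (cs : CoxeterSystem M W) (v w : W) : Prop :=
  ∃ t, cs.IsRightInversion w t ∧ w * t = v

/-- The Bruhat order, described as the reflexive and transitive closure of `BruhatStep`. -/
abbrev BruhatChain (cs : CoxeterSystem M W) : W → W → Prop :=
  Relation.ReflTransGen cs.BruhatStep

theorem IsRightDescent.bruhatStep {cs : CoxeterSystem M W} {w : W} {i : B}
    (h : cs.IsRightDescent w i) : cs.BruhatStep (w * cs.simple i) w :=
  ⟨cs.simple i, (cs.isRightInversion_simple_iff_isRightDescent w i).mpr h, rfl⟩

theorem BruhatStep.mul_simple {cs : CoxeterSystem M W} {v w : W} (h : cs.BruhatStep v w) (i : B) :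
    cs.BruhatStep (v * cs.simple i) (w * cs.simple i) ∨ v * cs.simple i = w := by
  obtain ⟨t, ht, rfl⟩ := h
  by_cases hts : w * t * cs.simple i = w
  · exact .inr hts
  have hr : cs.IsReflection (cs.simple i * t * cs.simple i) := by
    simpa using ht.1.conj (cs.simple i)
  refine .inl ⟨cs.simple i * t * cs.simple i, ⟨hr, ?_⟩, by simp [mul_assoc]⟩
  have hmul : w * cs.simple i * (cs.simple i * t * cs.simple i) = w * t * cs.simple i := by
    simp [mul_assoc]
  rw [hmul]
  have hlt := ht.2
  by_cases hd : cs.IsRightDescent w i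
  · obtain ⟨ω, hω, hprod⟩ := cs.exists_isReduced (w * cs.simple i)
    have hw : cs.wordProd (ω ++ [i]) = w := by simp [wordProd_append, ← hprod]
    obtain ⟨j, hj, heq⟩ := IsRightInversion.exists_eraseIdx (ω := ω ++ [i]) (hw ▸ ht)
    rw [hw] at heq
    rcases Nat.lt_or_ge j ω.length with hjω | hjω
    · rw [List.eraseIdx_append_of_lt_length hjω, wordProd_append] at heq
      rw [heq, hprod, hω.eq]
      calc _ = cs.length (cs.wordProd (ω.eraseIdx j)) := by simp
        _ ≤ (ω.eraseIdx j).length := cs.length_wordProd_le _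
        _ < ω.length := by rw [List.length_eraseIdx_of_lt hjω]; omega
    · obtain rfl : j = ω.length := by simp at hj; omega
      rw [List.eraseIdx_append_of_length_le le_rfl] at heq
      refine absurd ?_ hts
      rw [heq]
      simp [← hprod]
  · rw [not_isRightDescent_iff] at hd
    rcases cs.length_mul_simple (w * t) i with h | h <;> omega

theorem BruhatChain.mul_simple {cs : CoxeterSystem M W} {v w : W} (h : cs.BruhatChain v w)
    (i : B) : cs.BruhatChain (v * cs.simple i) w ∨
      cs.BruhatChain (v * cs.simple i) (w * cs.simple i) := by
  induction h using Relation.ReflTransGen.head_induction_on with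
  | refl => exact .inr .refl
  | head hstep hchain ih =>
    rcases hstep.mul_simple i with h | h
    · exact ih.imp (.head h) (.head h)
    · exact .inl (h ▸ hchain)

/-- The **lifting property** of the Bruhat order. -/
theorem BruhatChain.mul_simple_of_isRightDescent {cs : CoxeterSystem M W} {v w : W} {i : B}
    (h : cs.BruhatChain v w) (hd : cs.IsRightDescent w i) :
    cs.BruhatChain (v * cs.simple i) w :=
  (h.mul_simple i).elim id fun h' => h'.tail hd.bruhatStep

theorem BruhatChain.exists_sublist {cs : CoxeterSystem M W} {v : W} {ω : List B}
    (h : cs.BruhatChain v (cs.wordProd ω)) : ∃ ω', ω'.Sublist ω ∧ cs.wordProd ω' = v := by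
  induction h using Relation.ReflTransGen.head_induction_on with
  | refl => exact ⟨ω, .refl ω, rfl⟩
  | head hstep _ ih =>
    obtain ⟨ω', hsub, rfl⟩ := ih
    obtain ⟨t, ht, rfl⟩ := hstep
    obtain ⟨j, -, hj⟩ := ht.exists_eraseIdx
    exact ⟨_, (List.eraseIdx_sublist ω' j).trans hsub, hj.symm⟩

theorem IsReduced.bruhatChain_of_sublist {cs : CoxeterSystem M W} {ω ω' : List B}
    (hω : cs.IsReduced ω) (h : ω'.Sublist ω) :
    cs.BruhatChain (cs.wordProd ω') (cs.wordProd ω) := by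
  induction ω using List.reverseRecOn generalizing ω' with
  | nil => rw [List.sublist_nil.mp h]
  | append_singleton ω i ih =>
    have hred : cs.IsReduced ω := by simpa using hω.take ω.length
    have hprod : cs.wordProd (ω ++ [i]) = cs.wordProd ω * cs.simple i := by
      simp [wordProd_append]
    have hd : cs.IsRightDescent (cs.wordProd (ω ++ [i])) i := by
      rw [IsRightDescent, hω.eq, hprod, simple_mul_simple_cancel_right, hred.eq]
      simp
    have hstep : cs.BruhatStep (cs.wordProd ω) (cs.wordProd (ω ++ [i])) := by
      simpa [hprod] using hd.bruhatStep
    obtain ⟨ω₁, ω₂, rfl, h₁, h₂⟩ := List.sublist_append_iff.mp h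
    have hchain := (ih hred h₁).tail hstep
    rcases List.sublist_singleton.mp h₂ with rfl | rfl
    · simpa using hchain
    · simpa [wordProd_append] using BruhatChain.mul_simple_of_isRightDescent hchain hd

theorem bruhatLE_iff_bruhatChain (cs : CoxeterSystem M W) {v w : W} :
    bruhatLE cs v w ↔ cs.BruhatChain v w := by
  constructor
  · rintro ⟨ω, rfl, hω, ω', hsub, rfl⟩
    exact IsReduced.bruhatChain_of_sublist (cs := cs) hω.symm hsub
  · intro h
    obtain ⟨ω, hω, rfl⟩ := cs.exists_isReduced w
    exact ⟨ω, rfl, hω.symm, h.exists_sublist⟩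

theorem bruhatLE_mul_simple_iff (cs : CoxeterSystem M W) {v w : W} {i : B}
    (hd : cs.IsRightDescent w i) : bruhatLE cs (v * cs.simple i) w ↔ bruhatLE cs v w := by
  simp only [bruhatLE_iff_bruhatChain]
  refine ⟨fun h => ?_, fun h => BruhatChain.mul_simple_of_isRightDescent h hd⟩
  simpa using BruhatChain.mul_simple_of_isRightDescent h hd

end CoxeterSystem

/-! ### Products in the Hecke algebra -/

theorem Tmap_mul (cs : CoxeterSystem M W) {u v : W}
    (h : cs.length (u * v) = cs.length u + cs.length v) :
    Tmap cs u * Tmap cs v = Tmap cs (u * v) := by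
  have hb : bOf cs u * bOf cs v = bOf cs (u * v) :=
    PresentedMonoid.mk_eq_mk_of_rel ⟨u, v, h, rfl, rfl⟩
  rw [Tmap, Tmap, Tmap, ← map_mul, ← map_mul, hb]

theorem mul_self_eq_mul_add_one_of_mul_sub_eq_zero {R : Type*} [Ring R] {a x : R}
    (h : (a + 1) * (a - x) = 0) : (a + 1) * (a + 1) = (a + 1) * (x + 1) := by
  rw [← sub_eq_zero, ← mul_sub, add_sub_add_right_eq_sub, h]

theorem Tmap_simple_add_one_mul_self (cs : CoxeterSystem M W) (i : B) :
    (Tmap cs (cs.simple i) + 1) * (Tmap cs (cs.simple i) + 1) =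
      algebraMap LaurA (Hecke cs) (xA + 1) * (Tmap cs (cs.simple i) + 1) := by
  have hrel := RingQuot.mkRingHom_rel (r := heckeRel cs) ⟨i, rfl, rfl⟩
  have hx : RingQuot.mkRingHom (heckeRel cs) (algebraMap LaurA (HeckeCarrier cs) xA) =
      algebraMap LaurA (Hecke cs) xA := by
    rw [← RingQuot.mkAlgHom_coe LaurA (heckeRel cs)]
    exact (RingQuot.mkAlgHom LaurA (heckeRel cs)).commutes xA
  rw [map_mul, map_add, map_sub, map_one, map_zero, hx] at hrel
  change (Tmap cs (cs.simple i) + 1) * (Tmap cs (cs.simple i) - _) = 0 at hrel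
  rw [Algebra.commutes, map_add, map_one]
  exact mul_self_eq_mul_add_one_of_mul_sub_eq_zero (R := Hecke cs) hrel

open scoped Classical in
/-- If `s` is a right descent of `w`, then `T_{w̲}` is the right multiple by `T_s + 1` of the sum of
the `T_v` over the `v ≤ w` of which `s` is not a right descent. -/
theorem Tbar_eq_sum_mul [Fintype W] (cs : CoxeterSystem M W) {w : W} {i : B}
    (h : cs.IsRightDescent w i) :
    Tbar cs w = (∑ v : W with bruhatLE cs v w ∧ ¬ cs.IsRightDescent v i, Tmap cs v) *
      (Tmap cs (cs.simple i) + 1) := by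
  have hdesc : ∑ v : W with bruhatLE cs v w ∧ cs.IsRightDescent v i, Tmap cs v =
      ∑ v : W with bruhatLE cs v w ∧ ¬ cs.IsRightDescent v i,
        Tmap cs v * Tmap cs (cs.simple i) := by
    refine Finset.sum_bij' (fun v _ => v * cs.simple i) (fun v _ => v * cs.simple i)
      ?_ ?_ ?_ ?_ ?_
    · intro v hv
      rw [Finset.mem_filter_univ] at hv ⊢
      rwa [cs.bruhatLE_mul_simple_iff h, ← cs.isRightDescent_iff_not_isRightDescent_mul]
    · intro v hv
      rw [Finset.mem_filter_univ] at hv ⊢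
      rwa [cs.bruhatLE_mul_simple_iff h, cs.isRightDescent_iff_not_isRightDescent_mul,
        cs.simple_mul_simple_cancel_right]
    · simp
    · simp
    · intro v hv
      have hd := cs.isRightDescent_iff.mp (Finset.mem_filter.mp hv).2.2
      rw [Tmap_mul cs (by simp [hd]), cs.simple_mul_simple_cancel_right]
  rw [Tbar, ← Finset.sum_filter, ← Finset.sum_filter_add_sum_filter_not _
    (fun v => cs.IsRightDescent v i), Finset.filter_filter, Finset.filter_filter, hdesc, mul_add,
    mul_one, Finset.sum_mul]

/-- If `w ∈ W` and `s ∈ S` satisfy `l(ws) < l(w)`, then in `H_x(W)`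
one has `T_{w̲}·(T_s + 1) = (x + 1)·T_{w̲}`. -/
theorem stmt15 [Fintype W] (cs : CoxeterSystem M W) (w : W) (i : B)
    (h : cs.length (w * cs.simple i) < cs.length w) :
    Tbar cs w * (Tmap cs (cs.simple i) + 1) =
      algebraMap LaurA (Hecke cs) (xA + 1) * Tbar cs w := by
  rw [Tbar_eq_sum_mul cs h, mul_assoc, Tmap_simple_add_one_mul_self, ← mul_assoc,
    ← Algebra.commutes, mul_assoc]
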